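/- Let m ≥ 2 be an integer and let D = (V,E,w) be a vertex-weighted oriented m-partite graph of the first class (with m parts). Assume w(x) = 1 for every source vertex of D (i.e., every vertex of V_1) and w(x) ≥ 2 for every x ∈ V \ (V_1 ⊔ V_m). Then the projective dimension of the edge ideal satisfies pd(I(D)) = |V| − 2. -/

import Mathlib

open MvPolynomial

noncomputable section

namespace WOG

variable {k : Type} [Field k]

/-- The maximal graded ideal `(x : x ∈ V)` of the polynomial ring. -/
def mIdeal (k V : Type) [Field k] : Ideal (MvPolynomial V k) :=
  Ideal.span (Set.range (X : V → MvPolynomial V k))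

/-- The edge ideal `I(D) = (x * y^{w(y)} : (x,y) ∈ E)` of a vertex-weighted
oriented graph `D = (V, E, w)`. -/
def edgeIdeal (k : Type) [Field k] {V : Type} (E : Set (V × V)) (w : V → ℕ) :
    Ideal (MvPolynomial V k) :=
  Ideal.span {p : MvPolynomial V k | ∃ e ∈ E, p = X e.1 * X e.2 ^ w e.2}

/-- A minimal graded free resolution `⋯ → F₁ → F₀ → I → 0` of an ideal
`I` of the polynomial ring `S = k[x : x ∈ V]`, where `Fᵢ` is the graded free
module with (finite) homogeneous basis `ι i` whose element `a` sits in degree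
`deg i a` (i.e. `Fᵢ = ⊕_a S(- deg i a)`), the maps are graded (degree-preserving)
`S`-linear maps, the complex is exact, and all the matrix entries of the
differentials lie in the maximal graded ideal `𝔪 = (x : x ∈ V)` (minimality). -/
structure MinFreeRes {V : Type} (I : Ideal (MvPolynomial V k)) where
  ι : ℕ → Type
  finite : ∀ i, Finite (ι i)
  deg : ∀ i, ι i → ℕ
  aug : ((ι 0) →₀ MvPolynomial V k) →ₗ[MvPolynomial V k] MvPolynomial V k
  d : ∀ i, ((ι (i + 1)) →₀ MvPolynomial V k) →ₗ[MvPolynomial V k] ((ι i) →₀ MvPolynomial V k)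
  aug_range : LinearMap.range aug = I
  exact_zero : LinearMap.range (d 0) = LinearMap.ker aug
  exact_succ : ∀ i, LinearMap.range (d (i + 1)) = LinearMap.ker (d i)
  aug_homog : ∀ a, (aug (Finsupp.single a 1)).IsHomogeneous (deg 0 a)
  d_homog : ∀ i a b, (d i (Finsupp.single a 1)) b = 0 ∨
      ∃ e, deg (i + 1) a = deg i b + e ∧ ((d i (Finsupp.single a 1)) b).IsHomogeneous e
  minimal : ∀ i a b, (d i (Finsupp.single a 1)) b ∈ mIdeal k V

/-- The graded Betti number `β_{i,j}(I)`, read off from a minimal graded free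
resolution: the number of basis elements of `Fᵢ` of degree `j`. -/
def MinFreeRes.betti {V : Type} {I : Ideal (MvPolynomial V k)} (R : MinFreeRes I)
    (i j : ℕ) : ℕ :=
  Nat.card {a : R.ι i // R.deg i a = j}

/-- The set `{j - i : β_{i,j}(I) ≠ 0}`; its greatest element is the
Castelnuovo–Mumford regularity `reg I`. -/
def MinFreeRes.regSet {V : Type} {I : Ideal (MvPolynomial V k)} (R : MinFreeRes I) :
    Set ℤ :=
  {t : ℤ | ∃ i j : ℕ, R.betti i j ≠ 0 ∧ t = (j : ℤ) - (i : ℤ)}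

/-- The set `{i : β_{i,j}(I) ≠ 0 for some j}`; its greatest element is the
projective dimension `pd I`. -/
def MinFreeRes.pdSet {V : Type} {I : Ideal (MvPolynomial V k)} (R : MinFreeRes I) :
    Set ℕ :=
  {i : ℕ | ∃ j : ℕ, R.betti i j ≠ 0}

/-- The set of lengths of `I`-regular sequences contained in the maximal graded
ideal `𝔪 = (x : x ∈ V)`; its greatest element is `depth I`. -/
def depthSet (k : Type) [Field k] {V : Type} (I : Ideal (MvPolynomial V k)) : Set ℕ :=
  {n : ℕ | ∃ rs : List (MvPolynomial V k), rs.length = n ∧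
    (∀ r ∈ rs, r ∈ mIdeal k V) ∧ RingTheory.Sequence.IsRegular (↥I) rs}

end WOG

namespace WOG

section Complex

variable {S : Type*} [CommRing S]

/-- The submodule `J F` of the free module `F` with basis `κ`: vectors with all entries in `J`. -/
def entriesIn (J : Ideal S) (κ : Type*) : Submodule S (κ →₀ S) :=
  Finsupp.submodule fun _ => J

theorem mem_entriesIn {J : Ideal S} {κ : Type*} {z : κ →₀ S} :
    z ∈ entriesIn J κ ↔ ∀ b, z b ∈ J :=
  Finsupp.mem_submodule_iff _ _

theorem entriesIn_mono {J J' : Ideal S} (h : J ≤ J') (κ : Type*) :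
    entriesIn J κ ≤ entriesIn J' κ :=
  fun _ hz => mem_entriesIn.2 fun b => h (mem_entriesIn.1 hz b)

theorem map_mem_entriesIn {κ κ' : Type*} (f : (κ →₀ S) →ₗ[S] (κ' →₀ S)) {J : Ideal S}
    {z : κ →₀ S} (hz : z ∈ entriesIn J κ) : f z ∈ entriesIn J κ' := by
  rw [← Finsupp.sum_single z, Finsupp.sum, map_sum]
  refine Submodule.sum_mem _ fun b _ => mem_entriesIn.2 fun c => ?_
  have h : Finsupp.single b (z b) = z b • Finsupp.single b (1 : S) := by simp
  rw [h, map_smul, Finsupp.smul_apply, smul_eq_mul]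
  exact J.mul_mem_right _ (mem_entriesIn.1 hz b)

theorem map_mem_entriesIn_of_basis {κ κ' : Type*} (f : (κ →₀ S) →ₗ[S] (κ' →₀ S)) {J : Ideal S}
    (hf : ∀ a b, f (Finsupp.single a 1) b ∈ J) (z : κ →₀ S) : f z ∈ entriesIn J κ' := by
  rw [← Finsupp.sum_single z, Finsupp.sum, map_sum]
  refine Submodule.sum_mem _ fun b _ => mem_entriesIn.2 fun c => ?_
  have h : Finsupp.single b (z b) = z b • Finsupp.single b (1 : S) := by simp
  rw [h, map_smul, Finsupp.smul_apply, smul_eq_mul]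
  exact J.mul_mem_left _ (hf b c)

theorem smul_mem_entriesIn_sup (J : Ideal S) (x : S) {κ : Type*} (z : κ →₀ S) :
    x • z ∈ entriesIn (J ⊔ Ideal.span {x}) κ :=
  mem_entriesIn.2 fun b => by
    rw [Finsupp.smul_apply, smul_eq_mul]
    exact Ideal.mul_mem_right _ _ (Ideal.mem_sup_right (Ideal.mem_span_singleton_self x))

theorem exists_sub_smul_mem_entriesIn {J : Ideal S} {x : S} {κ : Type*} {z : κ →₀ S}
    (hz : z ∈ entriesIn (J ⊔ Ideal.span {x}) κ) : ∃ u : κ →₀ S, z - x • u ∈ entriesIn J κ := by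
  suffices h : z ∈ entriesIn J κ ⊔ LinearMap.range (LinearMap.lsmul S (κ →₀ S) x) by
    obtain ⟨j, hj, _, ⟨u, rfl⟩, rfl⟩ := Submodule.mem_sup.1 h
    exact ⟨u, by simpa using hj⟩
  rw [← Finsupp.sum_single z]
  refine Submodule.sum_mem _ fun b _ => ?_
  obtain ⟨j, hj, y, hy, e⟩ := Submodule.mem_sup.1 (mem_entriesIn.1 hz b)
  obtain ⟨c, rfl⟩ := Ideal.mem_span_singleton.1 hy
  rw [← e, Finsupp.single_add]
  refine Submodule.add_mem_sup (mem_entriesIn.2 fun b' => ?_) ⟨Finsupp.single b c, by simp⟩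
  classical
  rw [Finsupp.single_apply]
  split_ifs
  exacts [hj, J.zero_mem]

theorem mem_entriesIn_of_smul {J : Ideal S} {x : S} (hx : ∀ s, x * s ∈ J → s ∈ J) {κ : Type*}
    {z : κ →₀ S} (hz : x • z ∈ entriesIn J κ) : z ∈ entriesIn J κ :=
  mem_entriesIn.2 fun b => hx _ (by simpa using mem_entriesIn.1 hz b)

variable {κ : ℕ → Type} (d : ∀ i, (κ (i + 1) →₀ S) →ₗ[S] (κ i →₀ S))

/-- The complex `F / J F` is exact at position `i + 1`. -/
def ExactMod (J : Ideal S) (i : ℕ) : Prop :=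
  ∀ z, d i z ∈ entriesIn J (κ i) → ∃ y, z - d (i + 1) y ∈ entriesIn J (κ (i + 1))

/-- The cokernel of `F_{i+1} / J → F_i / J` has a nonzero element killed by the ideal `m`. -/
def HasSocle (m J : Ideal S) (i : ℕ) : Prop :=
  ∃ z, (∀ y, z - d i y ∉ entriesIn J (κ i)) ∧
    ∀ v ∈ m, ∃ y, v • z - d i y ∈ entriesIn J (κ i)

variable {d}

theorem ExactMod.succ (hd : ∀ i z, d i (d (i + 1) z) = 0) {J : Ideal S} {x : S}
    (hx : ∀ s, x * s ∈ J → s ∈ J) {i : ℕ} (h₀ : ExactMod d J i) (h₁ : ExactMod d J (i + 1)) :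
    ExactMod d (J ⊔ Ideal.span {x}) (i + 1) := by
  intro z hz
  obtain ⟨u, hu⟩ := exists_sub_smul_mem_entriesIn hz
  have hdu : d i u ∈ entriesIn J (κ i) := by
    refine mem_entriesIn_of_smul hx ?_
    have := map_mem_entriesIn (d i) hu
    rwa [map_sub, hd, map_smul, zero_sub, neg_mem_iff] at this
  obtain ⟨y, hy⟩ := h₀ u hdu
  obtain ⟨t, ht⟩ := h₁ (z - x • y) (by
    have := add_mem hu (Submodule.smul_mem _ x hy)
    convert this using 1
    rw [map_sub, map_smul, smul_sub]
    abel)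
  refine ⟨t, ?_⟩
  have := add_mem (entriesIn_mono (le_sup_left (b := Ideal.span {x})) _ ht)
    (smul_mem_entriesIn_sup J x y)
  convert this using 1
  abel

theorem HasSocle.succ (hd : ∀ i z, d i (d (i + 1) z) = 0) {m J : Ideal S} {x : S} (hxm : x ∈ m)
    (hx : ∀ s, x * s ∈ J → s ∈ J) {i : ℕ} (h : ExactMod d J i) (hs : HasSocle d m J i) :
    HasSocle d m (J ⊔ Ideal.span {x}) (i + 1) := by
  obtain ⟨z, hz, hzm⟩ := hs
  obtain ⟨y, hy⟩ := hzm x hxm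
  refine ⟨y, fun t ht => ?_, fun v hv => ?_⟩
  · obtain ⟨s, hs⟩ := exists_sub_smul_mem_entriesIn ht
    refine hz s (mem_entriesIn_of_smul hx ?_)
    have := add_mem hy (map_mem_entriesIn (d i) hs)
    convert this using 1
    rw [map_sub, map_sub, hd, map_smul, smul_sub]
    abel
  · obtain ⟨t, ht⟩ := hzm v hv
    obtain ⟨s, hs⟩ := h (v • y - x • t) (by
      have := sub_mem (Submodule.smul_mem _ x ht) (Submodule.smul_mem _ v hy)
      convert this using 1
      rw [map_sub, map_smul, map_smul, smul_sub, smul_sub, smul_comm x v]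
      abel)
    refine ⟨s, ?_⟩
    have := add_mem (entriesIn_mono (le_sup_left (b := Ideal.span {x})) _ hs)
      (smul_mem_entriesIn_sup J x t)
    convert this using 1
    abel

end Complex

section Resolution

variable {V : Type} {k : Type} [Field k] {I : Ideal (MvPolynomial V k)}

/-- Basis index types of the resolution of `S / I` obtained by splicing `S` onto one of `I`. -/
def MinFreeRes.augIdx (R : MinFreeRes I) : ℕ → Type
  | 0 => Unit
  | i + 1 => R.ι i

/-- The isomorphism from `S` to the free module in degree zero of the spliced resolution. -/
def MinFreeRes.augUnit (R : MinFreeRes I) :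
    MvPolynomial V k →ₗ[MvPolynomial V k] (R.augIdx 0 →₀ MvPolynomial V k) :=
  Finsupp.lsingle ()

/-- The augmentation onto `I`, as a map on the spliced resolution. -/
def MinFreeRes.augMap (R : MinFreeRes I) :
    (R.augIdx 1 →₀ MvPolynomial V k) →ₗ[MvPolynomial V k] MvPolynomial V k :=
  R.aug

/-- Differentials of the resolution of `S / I` obtained by splicing `S` onto one of `I`. -/
def MinFreeRes.augD (R : MinFreeRes I) : ∀ i, (R.augIdx (i + 1) →₀ MvPolynomial V k)
    →ₗ[MvPolynomial V k] (R.augIdx i →₀ MvPolynomial V k)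
  | 0 => R.augUnit ∘ₗ R.augMap
  | i + 1 => R.d i

theorem MinFreeRes.augD_zero_apply (R : MinFreeRes I) (z : R.augIdx 1 →₀ MvPolynomial V k) :
    R.augD 0 z = R.augUnit (R.augMap z) := rfl

theorem MinFreeRes.augUnit_mem_entriesIn (R : MinFreeRes I) {J : Ideal (MvPolynomial V k)}
    {p : MvPolynomial V k} : R.augUnit p ∈ entriesIn J (R.augIdx 0) ↔ p ∈ J := by
  have h (c : R.augIdx 0) : R.augUnit p c = p := Finsupp.single_eq_same (a := ())
  rw [mem_entriesIn]
  exact ⟨fun hp => h () ▸ hp (), fun hp c => (h c).symm ▸ hp⟩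

theorem MinFreeRes.augMap_range (R : MinFreeRes I) : LinearMap.range R.augMap = I :=
  R.aug_range

theorem MinFreeRes.augD_eq_zero_iff (R : MinFreeRes I) (i : ℕ)
    (z : R.augIdx (i + 1) →₀ MvPolynomial V k) :
    R.augD i z = 0 ↔ ∃ y, R.augD (i + 1) y = z := by
  cases i with
  | zero =>
    have h : R.augD 0 z = 0 ↔ z ∈ LinearMap.ker R.augMap :=
      Finsupp.single_eq_zero (a := ())
    exact h.trans (SetLike.ext_iff.1 R.exact_zero z).symm
  | succ i => exact (SetLike.ext_iff.1 (R.exact_succ i) z).symm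

theorem MinFreeRes.augD_augD (R : MinFreeRes I) (i : ℕ)
    (z : R.augIdx (i + 2) →₀ MvPolynomial V k) : R.augD i (R.augD (i + 1) z) = 0 :=
  (R.augD_eq_zero_iff i _).2 ⟨z, rfl⟩

theorem MinFreeRes.exactMod_bot (R : MinFreeRes I) (i : ℕ) : ExactMod R.augD ⊥ i := by
  intro z hz
  obtain ⟨y, rfl⟩ := (R.augD_eq_zero_iff i z).1 (Finsupp.ext fun b => mem_entriesIn.1 hz b)
  exact ⟨y, by simp⟩

theorem MinFreeRes.exactMod_span_singleton (R : MinFreeRes I) {l : MvPolynomial V k}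
    (hl0 : l ≠ 0) (hl : ∀ s, l * s ∈ I → s ∈ I) (i : ℕ) :
    ExactMod R.augD (Ideal.span {l}) i := by
  cases i with
  | zero =>
    intro z hz
    rw [R.augD_zero_apply, R.augUnit_mem_entriesIn] at hz
    obtain ⟨c, hc⟩ := Ideal.mem_span_singleton.1 hz
    have hcI : c ∈ I := hl c (by
      rw [← hc]
      exact (SetLike.ext_iff.1 R.augMap_range _).1 ⟨z, rfl⟩)
    obtain ⟨u, rfl⟩ := (SetLike.ext_iff.1 R.augMap_range c).2 hcI
    obtain ⟨y, hy⟩ := (R.augD_eq_zero_iff 0 (z - l • u)).1 (by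
      rw [R.augD_zero_apply, map_sub, map_smul, hc, smul_eq_mul, sub_self, map_zero])
    refine ⟨y, ?_⟩
    rw [hy, sub_sub_cancel]
    simpa using smul_mem_entriesIn_sup ⊥ l u
  | succ i =>
    have := (R.exactMod_bot i).succ R.augD_augD (x := l)
      (fun s hs => by simpa [hl0] using hs) (R.exactMod_bot (i + 1))
    rwa [bot_sup_eq] at this

/-- The ideal generated by `x_a + x_b` and the variables in `T`. -/
def linIdeal (k : Type) [Field k] (a b : V) (T : Finset V) : Ideal (MvPolynomial V k) :=
  Ideal.span {X a + X b} ⊔ Ideal.span (X '' (T : Set V))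

theorem linIdeal_insert [DecidableEq V] (a b v : V) (T : Finset V) :
    linIdeal k a b (insert v T) = linIdeal k a b T ⊔ Ideal.span {X v} := by
  rw [linIdeal, linIdeal, Finset.coe_insert, Set.image_insert_eq, Ideal.span_insert, sup_assoc,
    sup_comm (Ideal.span {X v})]

theorem linIdeal_empty (a b : V) : linIdeal k a b ∅ = Ideal.span {X a + X b} := by
  simp [linIdeal]

theorem linIdeal_regular {a b : V} (hab : a ≠ b) {T : Finset V}
    {v : V} (hva : v ≠ a) (hv : v ∉ T) (haT : a ∉ T) {s : MvPolynomial V k}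
    (hs : X v * s ∈ linIdeal k a b T) : s ∈ linIdeal k a b T := by
  classical
  let c : V → MvPolynomial V k := fun u => if u ∈ T then 0 else X u
  let φ : MvPolynomial V k →ₐ[k] MvPolynomial V k :=
    aeval fun u => if u = a then - c b else c u
  have hφX (u : V) : φ (X u) = if u = a then - c b else c u := aeval_X _ _
  have hker : ∀ p ∈ linIdeal k a b T, φ p = 0 := by
    suffices linIdeal k a b T ≤ RingHom.ker φ from fun p hp => this hp
    refine sup_le ?_ ?_
    · rw [Ideal.span_singleton_le_iff_mem, RingHom.mem_ker, map_add, hφX, hφX]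
      simp [hab.symm]
    · rw [Ideal.span_le]
      rintro _ ⟨u, hu, rfl⟩
      have hua : u ≠ a := fun h => haT (h ▸ hu)
      have hu' : u ∈ T := hu
      simp [hφX, hua, c, hu']
  have hc (u : V) : c u - X u ∈ linIdeal k a b T := by
    by_cases hu : u ∈ T
    · have h : X u ∈ linIdeal k a b T :=
        Ideal.mem_sup_right (Ideal.subset_span ⟨u, hu, rfl⟩)
      simpa [c, hu] using h
    · simp [c, hu]
  have hmod : (Ideal.Quotient.mkₐ k (linIdeal k a b T)).comp φ = Ideal.Quotient.mkₐ k _ := by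
    refine algHom_ext fun u => ?_
    rw [AlgHom.comp_apply, Ideal.Quotient.mkₐ_eq_mk, Ideal.Quotient.eq, hφX]
    split_ifs with h
    · subst h
      have h1 : X u + X b ∈ linIdeal k u b T :=
        Ideal.mem_sup_left (Ideal.mem_span_singleton_self _)
      convert neg_mem (add_mem h1 (hc b)) using 1
      ring
    · exact hc u
  have h0 := hker _ hs
  rw [map_mul, hφX, if_neg hva, show c v = X v from if_neg hv] at h0
  have h1 : φ s = 0 := (mul_eq_zero.1 h0).resolve_left (X_ne_zero v)
  have h2 := DFunLike.congr_fun hmod s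
  rw [AlgHom.comp_apply, h1, map_zero, Ideal.Quotient.mkₐ_eq_mk] at h2
  exact Ideal.Quotient.eq_zero_iff_mem.1 h2.symm

theorem X_mem_mIdeal (v : V) : (X v : MvPolynomial V k) ∈ mIdeal k V :=
  Ideal.subset_span ⟨v, rfl⟩

theorem linIdeal_univ_erase [Fintype V] [DecidableEq V] {a b : V} (hab : a ≠ b) :
    linIdeal k a b (Finset.univ.erase a) = mIdeal k V := by
  refine le_antisymm (sup_le ?_ ?_) ?_
  · rw [Ideal.span_singleton_le_iff_mem]
    exact add_mem (X_mem_mIdeal a) (X_mem_mIdeal b)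
  · exact Ideal.span_mono (Set.image_subset_range _ _)
  · have h (v : V) (hv : v ≠ a) : X v ∈ linIdeal k a b (Finset.univ.erase a) :=
      Ideal.mem_sup_right (Ideal.subset_span ⟨v, by simpa using hv, rfl⟩)
    refine Ideal.span_le.2 ?_
    rintro _ ⟨v, rfl⟩
    by_cases hv : v = a
    · subst hv
      have h1 : X v + X b ∈ linIdeal k v b (Finset.univ.erase v) :=
        Ideal.mem_sup_left (Ideal.mem_span_singleton_self _)
      simpa using sub_mem h1 (h b hab.symm)
    · exact h v hv

theorem one_notMem_mIdeal : (1 : MvPolynomial V k) ∉ mIdeal k V := by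
  intro h
  have h1 : mIdeal k V ≤ RingHom.ker (constantCoeff : MvPolynomial V k →+* k) := by
    refine Ideal.span_le.2 ?_
    rintro _ ⟨v, rfl⟩
    simp
  simpa using h1 h

/-- If `x_a + x_b` is regular on `S / I` and `S / (I + (x_a + x_b))` has a nonzero socle, then
`S / I` has depth one, and so the last nonzero module in a minimal resolution of `I` sits in
homological degree `|V| - 2`. -/
theorem MinFreeRes.isGreatest_pdSet [Fintype V] (R : MinFreeRes I) {a b : V} (hab : a ≠ b)
    (hreg : ∀ s, (X a + X b) * s ∈ I → s ∈ I) {g : MvPolynomial V k}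
    (hg : g ∉ I ⊔ Ideal.span {X a + X b})
    (hgm : ∀ v, X v * g ∈ I ⊔ Ideal.span {X a + X b}) :
    IsGreatest R.pdSet (Fintype.card V - 2) := by
  classical
  have hl0 : (X a + X b : MvPolynomial V k) ≠ 0 := by
    intro h
    have h1 := congrArg (coeff (Finsupp.single a 1)) h
    simp [coeff_X, Finsupp.single_left_inj, hab.symm] at h1
  have hcoker (p : MvPolynomial V k) : p ∈ I ⊔ Ideal.span {X a + X b} ↔
      ∃ y, R.augUnit p - R.augD 0 y ∈ entriesIn (Ideal.span {X a + X b}) (R.augIdx 0) := by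
    simp_rw [R.augD_zero_apply, ← map_sub, R.augUnit_mem_entriesIn]
    refine ⟨fun h => ?_, fun ⟨y, h⟩ => ?_⟩
    · obtain ⟨i, hi, l, hl, rfl⟩ := Submodule.mem_sup.1 h
      obtain ⟨y, rfl⟩ := (SetLike.ext_iff.1 R.augMap_range i).2 hi
      exact ⟨y, by rwa [add_sub_cancel_left]⟩
    · rw [← sub_add_cancel p (R.augMap y)]
      exact add_mem (Ideal.mem_sup_right h)
        (Ideal.mem_sup_left ((SetLike.ext_iff.1 R.augMap_range _).1 ⟨y, rfl⟩))
  have key (T : Finset V) : a ∉ T →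
      (∀ i, T.card ≤ i → ExactMod R.augD (linIdeal k a b T) i) ∧
        HasSocle R.augD (mIdeal k V) (linIdeal k a b T) T.card := by
    induction T using Finset.induction_on with
    | empty =>
      intro _
      rw [linIdeal_empty, Finset.card_empty]
      refine ⟨fun i _ => R.exactMod_span_singleton hl0 hreg i, R.augUnit g,
        fun y hy => hg ((hcoker g).2 ⟨y, hy⟩), fun v hv => ?_⟩
      have hvg : v * g ∈ I ⊔ Ideal.span {X a + X b} := by
        have : mIdeal k V ≤ (I ⊔ Ideal.span {X a + X b}).colon (Ideal.span {g}) := by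
          refine Ideal.span_le.2 ?_
          rintro _ ⟨u, rfl⟩
          exact Ideal.mem_colon_span_singleton.2 (hgm u)
        exact Ideal.mem_colon_span_singleton.1 (this hv)
      obtain ⟨y, hy⟩ := (hcoker _).1 hvg
      exact ⟨y, by rwa [← map_smul]⟩
    | insert v T hv ih =>
      intro haT
      rw [Finset.mem_insert, not_or] at haT
      obtain ⟨hex, hsoc⟩ := ih haT.2
      have hx (s : MvPolynomial V k) := linIdeal_regular (s := s) hab (Ne.symm haT.1) hv haT.2
      rw [linIdeal_insert, Finset.card_insert_of_notMem hv]
      refine ⟨fun i hi => ?_, hsoc.succ R.augD_augD (X_mem_mIdeal v) hx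
        (hex _ le_rfl)⟩
      obtain ⟨i, rfl⟩ : ∃ j, i = j + 1 := ⟨i - 1, by omega⟩
      exact (hex i (by omega)).succ R.augD_augD hx (hex _ (by omega))
  obtain ⟨hex, z, hz, -⟩ := key (Finset.univ.erase a) (Finset.notMem_erase a _)
  have hn : 2 ≤ Fintype.card V := Fintype.one_lt_card_iff.2 ⟨a, b, hab⟩
  obtain ⟨n, hn⟩ : ∃ n, Fintype.card V = n + 2 := ⟨_, (Nat.sub_add_cancel hn).symm⟩
  have hcard : (Finset.univ.erase a).card = n + 1 := by
    rw [Finset.card_erase_of_mem (Finset.mem_univ a), Finset.card_univ, hn]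
    rfl
  rw [linIdeal_univ_erase hab] at hex hz
  rw [hcard] at hex
  rw [hn, Nat.add_sub_cancel]
  constructor
  · have hne : Nonempty (R.ι n) := by
      by_contra hemp
      rw [not_nonempty_iff] at hemp
      have : IsEmpty (R.augIdx (Finset.univ.erase a).card) := by rw [hcard]; exact hemp
      exact hz 0 (mem_entriesIn.2 fun c => isEmptyElim c)
    obtain ⟨c⟩ := hne
    have := R.finite n
    have : Nonempty {e : R.ι n // R.deg n e = R.deg n c} := ⟨⟨c, rfl⟩⟩
    exact ⟨R.deg n c, Nat.card_pos.ne'⟩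
  · rintro i ⟨j, hj⟩
    by_contra! hi
    obtain ⟨⟨c, -⟩⟩ : Nonempty {e : R.ι i // R.deg i e = j} := (Nat.card_ne_zero.1 hj).1
    obtain ⟨i, rfl⟩ : ∃ j, i = j + 1 := ⟨i - 1, by omega⟩
    have c : R.augIdx (i + 2) := c
    have hmin (i : ℕ) (z : R.augIdx (i + 2) →₀ MvPolynomial V k) :
        R.augD (i + 1) z ∈ entriesIn (mIdeal k V) _ :=
      map_mem_entriesIn_of_basis (R.d i) (R.minimal i) z
    obtain ⟨y, hy⟩ := hex (i + 1) (by omega) (Finsupp.single c 1) (hmin _ _)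
    have h1 := mem_entriesIn.1 (add_mem hy (hmin _ y)) c
    rw [sub_add_cancel, Finsupp.single_eq_same] at h1
    exact one_notMem_mIdeal h1

end Resolution

section Layered

variable {V : Type} {k : Type} [Field k] {m : ℕ} {part : V → Fin m} {w : V → ℕ}

/-- The exponent vector `e` is divisible by a generator of the edge ideal. -/
def EdgeDvd (part : V → Fin m) (w : V → ℕ) (e : V →₀ ℕ) : Prop :=
  ∃ y z, (part z : ℕ) = part y + 1 ∧ 1 ≤ e y ∧ w z ≤ e z

theorem EdgeDvd.mono {e e' : V →₀ ℕ} (h : EdgeDvd part w e) (hle : e ≤ e') :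
    EdgeDvd part w e' := by
  obtain ⟨y, z, hyz, hy, hz⟩ := h
  exact ⟨y, z, hyz, hy.trans (hle y), hz.trans (hle z)⟩

theorem mem_edgeIdeal_iff {p : MvPolynomial V k} :
    p ∈ edgeIdeal k {p : V × V | (part p.2 : ℕ) = (part p.1 : ℕ) + 1} w ↔
      ∀ e ∈ p.support, EdgeDvd part w e := by
  classical
  have h : {p : MvPolynomial V k | ∃ e ∈ {p : V × V | (part p.2 : ℕ) = (part p.1 : ℕ) + 1},
      p = X e.1 * X e.2 ^ w e.2} = (fun s => monomial s (1 : k)) ''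
        {s | ∃ y z, (part z : ℕ) = part y + 1 ∧
          s = Finsupp.single y 1 + Finsupp.single z (w z)} := by
    have hm (y z : V) : (X y * X z ^ w z : MvPolynomial V k) =
        monomial (Finsupp.single y 1 + Finsupp.single z (w z)) 1 := by
      rw [X_pow_eq_monomial, X, monomial_mul, mul_one]
    ext q
    constructor
    · rintro ⟨⟨y, z⟩, hyz, rfl⟩
      exact ⟨_, ⟨y, z, hyz, rfl⟩, (hm y z).symm⟩
    · rintro ⟨_, ⟨y, z, hyz, rfl⟩, rfl⟩
      exact ⟨(y, z), hyz, (hm y z).symm⟩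
  rw [edgeIdeal, h, mem_ideal_span_monomial_image]
  refine forall₂_congr fun e _ => ?_
  constructor
  · rintro ⟨_, ⟨y, z, hyz, rfl⟩, hle⟩
    have h1 := hle y
    have h2 := hle z
    simp only [Finsupp.add_apply, Finsupp.single_eq_same] at h1 h2
    exact ⟨y, z, hyz, by omega, by omega⟩
  · rintro ⟨y, z, hyz, hy, hz⟩
    refine ⟨_, ⟨y, z, hyz, rfl⟩, fun v => ?_⟩
    have hne : y ≠ z := by rintro rfl; omega
    rw [Finsupp.add_apply, Finsupp.single_apply, Finsupp.single_apply]
    split_ifs with h1 h2 h2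
    · exact absurd (h1.trans h2.symm) hne
    · subst h1; omega
    · subst h2; omega
    · omega

theorem coeff_eq_zero_of_mem_edgeIdeal {p : MvPolynomial V k}
    (hp : p ∈ edgeIdeal k {p : V × V | (part p.2 : ℕ) = (part p.1 : ℕ) + 1} w)
    {e : V →₀ ℕ} (he : ¬ EdgeDvd part w e) : coeff e p = 0 := by
  by_contra h
  exact he (mem_edgeIdeal_iff.1 hp e (mem_support_iff.2 h))

theorem monomial_mem_edgeIdeal {e : V →₀ ℕ} (he : EdgeDvd part w e) :
    monomial e (1 : k) ∈ edgeIdeal k {p : V × V | (part p.2 : ℕ) = (part p.1 : ℕ) + 1} w := by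
  classical
  refine mem_edgeIdeal_iff.2 fun e' he' => ?_
  rw [support_monomial, if_neg one_ne_zero, Finset.mem_singleton] at he'
  exact he' ▸ he

theorem X_add_X_regular (hw : ∀ x : V, 1 ≤ w x) {a b : V} (ha : (part a : ℕ) = 0)
    (hb : (part b : ℕ) = 1) {p : MvPolynomial V k}
    (hp : (X a + X b) * p ∈ edgeIdeal k {p : V × V | (part p.2 : ℕ) = (part p.1 : ℕ) + 1} w) :
    p ∈ edgeIdeal k {p : V × V | (part p.2 : ℕ) = (part p.1 : ℕ) + 1} w := by
  classical
  have hab : a ≠ b := by rintro rfl; omega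
  by_contra hpI
  have hex : ∃ n, ∃ e ∈ p.support, ¬ EdgeDvd part w e ∧ e b = n := by
    by_contra! h
    exact hpI (mem_edgeIdeal_iff.2 fun e he => by_contra fun h1 => h _ e he h1 rfl)
  obtain ⟨e, hep, he, hen⟩ := Nat.find_spec hex
  have hmin (e' : V →₀ ℕ) (h1 : e' ∈ p.support) (h2 : ¬ EdgeDvd part w e') : e b ≤ e' b :=
    hen ▸ Nat.find_min' hex ⟨e', h1, h2, rfl⟩
  by_cases hea : EdgeDvd part w (e + Finsupp.single a 1)
  · obtain ⟨y, z, hyz, hy, hz⟩ := hea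
    have hza : a ≠ z := by rintro rfl; omega
    rw [Finsupp.add_apply, Finsupp.single_eq_of_ne' hza, add_zero] at hz
    have hya : y = a := by
      by_contra h
      rw [Finsupp.add_apply, Finsupp.single_eq_of_ne h, add_zero] at hy
      exact he ⟨y, z, hyz, hy, hz⟩
    subst hya
    have hey : e y = 0 := by
      by_contra h
      exact he ⟨y, z, hyz, by omega, hz⟩
    have heb : ¬ EdgeDvd part w (e + Finsupp.single b 1) := by
      rintro ⟨y', z', hyz', hy', hz'⟩
      rw [Finsupp.add_apply] at hy' hz'
      by_cases h1 : z' = b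
      · subst h1
        rw [Finsupp.single_eq_of_ne (by rintro rfl; omega)] at hy'
        exact he ⟨y', z, by omega, hy', hz⟩
      · rw [Finsupp.single_eq_of_ne h1] at hz'
        by_cases h2 : y' = b
        · subst h2
          exact he ⟨z, z', by omega, (hw z).trans hz, hz'⟩
        · rw [Finsupp.single_eq_of_ne h2] at hy'
          exact he ⟨y', z', hyz', hy', hz'⟩
    have h := coeff_eq_zero_of_mem_edgeIdeal hp heb
    rw [add_mul, coeff_add, coeff_X_mul', if_neg, zero_add, add_comm e, coeff_X_mul] at h
    · exact mem_support_iff.1 hep h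
    · simp [hey, hab.symm]
  · have h := coeff_eq_zero_of_mem_edgeIdeal hp hea
    rw [add_mul, coeff_add, coeff_X_mul' _ b, add_comm e, coeff_X_mul] at h
    split_ifs at h with hb'
    · have hb0 : e b ≠ 0 := by simpa [hab] using hb'
      have h1 : coeff (Finsupp.single a 1 + e - Finsupp.single b 1) p ≠ 0 := by
        intro h0
        rw [h0, add_zero] at h
        exact mem_support_iff.1 hep h
      have h2 := hmin _ (mem_support_iff.2 h1) fun h3 => hea (h3.mono (by
        rw [add_comm e]; exact tsub_le_self))
      have h3 : (Finsupp.single a 1 : V →₀ ℕ) b = 0 := Finsupp.single_eq_of_ne hab.symm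
      simp only [Finsupp.tsub_apply, Finsupp.add_apply, Finsupp.single_eq_same, h3] at h2
      omega
    · rw [add_zero] at h
      exact mem_support_iff.1 hep h

end Layered

end WOG

/-- **Theorem (first class, regularity).**
`D` is a vertex-weighted oriented `m`-partite graph (`m ≥ 2`) of the first
class: its vertex set is partitioned into nonempty parts `V_1, …, V_m`
(encoded by `part : V → Fin m`), and its edges are exactly all pairs going
from a vertex of `V_i` to a vertex of `V_{i+1}` (`1 ≤ i ≤ m-1`), i.e. each
`D_i` is a complete bipartite graph oriented from `V_i` to `V_{i+1}`.
Sources have weight `1` and vertices outside `V_1 ⊔ V_m` have weight `≥ 2`.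
Then `pd I(D) = |V| - 2`. -/
theorem first_class_pd (k : Type) [Field k] (m : ℕ) (hm : 2 ≤ m)
    (V : Type) [Fintype V] (part : V → Fin m) (hpart : ∀ i : Fin m, ∃ x : V, part x = i)
    (E : Set (V × V))
    (hE : E = {p : V × V | (part p.2 : ℕ) = (part p.1 : ℕ) + 1})
    (w : V → ℕ) (hw : ∀ x : V, 1 ≤ w x)
    (hsrc : ∀ x : V, (∀ y : V, (y, x) ∉ E) → w x = 1)
    (hw2 : ∀ x : V, (part x : ℕ) ≠ 0 → (part x : ℕ) ≠ m - 1 → 2 ≤ w x)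
    (R : WOG.MinFreeRes (WOG.edgeIdeal k E w)) :
    IsGreatest R.pdSet (Fintype.card V - 2) := by
  classical
  subst hE
  obtain ⟨a, ha⟩ := hpart ⟨0, by omega⟩
  obtain ⟨b, hb⟩ := hpart ⟨1, by omega⟩
  replace ha : (part a : ℕ) = 0 := by rw [ha]
  replace hb : (part b : ℕ) = 1 := by rw [hb]
  have hab : a ≠ b := by rintro rfl; omega
  have hw1 (x : V) (hx : (part x : ℕ) = 0) : w x = 1 :=
    hsrc x fun y hy => by
      have : (part x : ℕ) = part y + 1 := hy
      omega
  let f : V →₀ ℕ := Finsupp.equivFunOnFinite.symm fun v => w v - 1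
  have hf (v : V) : f v = w v - 1 := rfl
  have hdvd (x u : V) (hx : (part x : ℕ) = 0) (hu : (part u : ℕ) ≠ 0) :
      WOG.EdgeDvd part w (Finsupp.single u 1 + (Finsupp.single x 1 + f)) := by
    have hwu := hw u
    have hpu := (part u).isLt
    by_cases hu1 : (part u : ℕ) = 1
    · refine ⟨x, u, by omega, ?_, ?_⟩ <;>
        simp only [Finsupp.add_apply, Finsupp.single_eq_same, hf] <;> omega
    · obtain ⟨y, hy⟩ := hpart ⟨part u - 1, by omega⟩
      replace hy : (part y : ℕ) = part u - 1 := by rw [hy]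
      have hwy := hw2 y (by omega) (by omega)
      refine ⟨y, u, by omega, ?_, ?_⟩ <;>
        simp only [Finsupp.add_apply, Finsupp.single_eq_same, hf] <;> omega
  have hna : ¬ WOG.EdgeDvd part w (Finsupp.single a 1 + f) := by
    rintro ⟨y, z, hyz, -, hz⟩
    have hwz := hw z
    rw [Finsupp.add_apply, Finsupp.single_eq_of_ne (by rintro rfl; omega), hf] at hz
    omega
  have hnb : ¬ WOG.EdgeDvd part w (Finsupp.single b 1 + f) := by
    rintro ⟨y, z, hyz, hy, hz⟩
    have hwz := hw z
    by_cases hzb : z = b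
    · subst hzb
      have hwy := hw1 y (by omega)
      rw [Finsupp.add_apply, Finsupp.single_eq_of_ne (by rintro rfl; omega), hf] at hy
      omega
    · rw [Finsupp.add_apply, Finsupp.single_eq_of_ne hzb, hf] at hz
      omega
  have hXmul (v : V) (e : V →₀ ℕ) :
      (X v * monomial e 1 : MvPolynomial V k) = monomial (Finsupp.single v 1 + e) 1 := by
    rw [X, monomial_mul, mul_one]
  have hmem (x u : V) (hx : (part x : ℕ) = 0) (hu : (part u : ℕ) ≠ 0) :
      X u * (X x * monomial f (1 : k)) ∈
        WOG.edgeIdeal k {p : V × V | (part p.2 : ℕ) = (part p.1 : ℕ) + 1} w := by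
    rw [hXmul, hXmul]
    exact WOG.monomial_mem_edgeIdeal (hdvd x u hx hu)
  refine R.isGreatest_pdSet hab (fun s => WOG.X_add_X_regular hw ha hb)
    (g := X a * monomial f 1) ?_ ?_
  · intro h
    obtain ⟨i, hi, l, hl, e⟩ := Submodule.mem_sup.1 h
    obtain ⟨c, rfl⟩ := Ideal.mem_span_singleton.1 hl
    have hbc : X b * c ∈
        WOG.edgeIdeal k {p : V × V | (part p.2 : ℕ) = (part p.1 : ℕ) + 1} w := by
      refine WOG.X_add_X_regular hw ha hb ?_
      have := sub_mem (hmem a b ha (by omega)) (Ideal.mul_mem_left _ (X b) hi)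
      convert this using 1
      rw [← e]
      ring
    have hac : X a * (monomial f 1 - c) ∈
        WOG.edgeIdeal k {p : V × V | (part p.2 : ℕ) = (part p.1 : ℕ) + 1} w := by
      convert add_mem hi hbc using 1
      linear_combination -e
    have h1 := WOG.coeff_eq_zero_of_mem_edgeIdeal hbc hnb
    have h2 := WOG.coeff_eq_zero_of_mem_edgeIdeal hac hna
    rw [coeff_X_mul] at h1 h2
    simp [h1] at h2
  · intro v
    by_cases hv : (part v : ℕ) = 0
    · have h1 := hmem v b hv (by omega)
      have h2 : X v * (X a * monomial f (1 : k)) =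
          -(X b * (X v * monomial f 1)) + (X a + X b) * (X v * monomial f 1) := by ring
      rw [h2]
      exact Submodule.add_mem_sup (neg_mem h1)
        (Ideal.mul_mem_right _ _ (Ideal.mem_span_singleton_self _))
    · exact Ideal.mem_sup_left (hmem a v ha hv)
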